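/- Let k ≥ 1, let p_1, …, p_k ∈ ℝ², and let L = {a + t • v : t ∈ ℝ} and L' = {a' + t • v' : t ∈ ℝ} be two lines in ℝ² whose direction vectors v and v' are linearly independent. Then there exists exactly one polygonal curve q_0, q_1, …, q_k in ℝ² such that q_0 ∈ L, q_k ∈ L', and p_j = (q_{j−1} + q_j)/2 for j = 1, …, k. -/

import Mathlib

noncomputable section

/-- The plane. -/
abbrev E2 := EuclideanSpace ℝ (Fin 2)

/-- The line through `a` with direction vector `v`. -/
def LineThrough (a v : E2) : Set E2 := {x : E2 | ∃ t : ℝ, x = a + t • v}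

/-- The vertices obtained from `x` by successive reflection in `p 1`, `p 2`, …. -/
def midpointVertex {V : Type*} [AddCommGroup V] [Module ℝ V] (p : ℕ → V) (x : V) : ℕ → V
  | 0 => x
  | n + 1 => (2 : ℝ) • p (n + 1) - midpointVertex p x n

theorem midpointVertex_eq_add_smul {V : Type*} [AddCommGroup V] [Module ℝ V]
    (p : ℕ → V) (x : V) (n : ℕ) :
    midpointVertex p x n = midpointVertex p 0 n + (-1 : ℝ) ^ n • x := by
  induction n with
  | zero => simp [midpointVertex]
  | succ n ih =>
    simp only [midpointVertex]
    rw [ih, pow_succ]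
    module

theorem eq_midpoint_iff_eq_two_smul_sub {V : Type*} [AddCommGroup V] [Module ℝ V] (m x y : V) :
    m = midpoint ℝ x y ↔ y = (2 : ℝ) • m - x := by
  rw [eq_comm, midpoint_eq_iff, AffineEquiv.pointReflection_apply, eq_comm]
  simp only [vsub_eq_sub, vadd_eq_add]
  constructor
  · intro h
    rw [h]
    module
  · rintro rfl
    module

theorem eq_midpointVertex_of_midpoint {V : Type*} [AddCommGroup V] [Module ℝ V] {k : ℕ}
    {p : ℕ → V} {q : Fin (k + 1) → V}
    (hq : ∀ j : Fin k, p (j.val + 1) = midpoint ℝ (q j.castSucc) (q j.succ)) (j : Fin (k + 1)) :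
    q j = midpointVertex p (q 0) j := by
  induction j using Fin.induction with
  | zero => rfl
  | succ j ih =>
    rw [(eq_midpoint_iff_eq_two_smul_sub _ _ _).1 (hq j), ih]
    rfl

theorem exists_smul_add_smul_eq {v w : E2} (h : LinearIndependent ℝ ![v, w]) (x : E2) :
    ∃ s t : ℝ, s • v + t • w = x := by
  have htop := h.span_eq_top_of_card_eq_finrank (by simp)
  rw [Matrix.range_cons_cons_empty] at htop
  exact Submodule.mem_span_pair.1 (htop ▸ Submodule.mem_top)

theorem stmt5 (k : ℕ) (hk : 1 ≤ k) (p : ℕ → E2) (a v a' v' : E2)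
    (hind : LinearIndependent ℝ ![v, v']) :
    ∃! q : Fin (k + 1) → E2,
      q 0 ∈ LineThrough a v ∧ q (Fin.last k) ∈ LineThrough a' v' ∧
      ∀ j : Fin k, p (j.val + 1) = midpoint ℝ (q j.castSucc) (q j.succ) := by
  have hsq : (-1 : ℝ) ^ k * (-1) ^ k = 1 := by rw [← mul_pow]; norm_num
  obtain ⟨α, β, h⟩ :=
    exists_smul_add_smul_eq hind (a' - midpointVertex p 0 k - (-1 : ℝ) ^ k • a)
  refine ⟨fun j => midpointVertex p (a + ((-1 : ℝ) ^ k * α) • v) j,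
    ⟨⟨_, rfl⟩, ⟨-β, ?_⟩, fun j => (eq_midpoint_iff_eq_two_smul_sub _ _ _).2 rfl⟩, ?_⟩
  · simp only [Fin.val_last]
    rw [midpointVertex_eq_add_smul, smul_add, smul_smul, ← mul_assoc, hsq, one_mul]
    linear_combination (norm := module) h
  · rintro q ⟨⟨t, ht⟩, ⟨s, hs⟩, hq⟩
    have hlast := eq_midpointVertex_of_midpoint hq (Fin.last k)
    rw [hs, ht, Fin.val_last, midpointVertex_eq_add_smul] at hlast
    have hzero : ((-1 : ℝ) ^ k * t - α) • v + (-s - β) • v' = 0 := by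
      linear_combination (norm := module) -hlast - h
    have hcoef := (LinearIndependent.pair_iff.1 hind _ _ hzero).1
    have ht' : t = (-1 : ℝ) ^ k * α := by
      linear_combination (-1 : ℝ) ^ k * hcoef - t * hsq
    funext j
    rw [eq_midpointVertex_of_midpoint hq j, ht, ht']
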